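/- Let m ≥ 3 be an integer and a an integer with 1 ≤ a ≤ m−2, let q be complex with 0 < |q| < 1, and let x_1,…,x_{m−1} be complex numbers. Define the multivariate series K_m^{(a)}(x_1,…,x_{m−1}) = Σ_{c_1,…,c_{m−1}=0}^{∞} (−1)^{c_{m−1}} q^{c_{m−1}(c_{m−1}+1)/2} x_{m−1}^{c_{m−1}} · ( Π_{i=1}^{a−1} q^{c_i²} x_i^{c_i} [c_{i+1} choose c_i]_q ) · q^{c_a²} x_a^{c_a} [c_{a+1}+1 choose c_a]_q · ( Π_{i=a+1}^{m−2} q^{c_i²+c_i} x_i^{c_i} [c_{i+1} choose c_i]_q ), and for a = 0 define K_m^{(0)}(x_1,…,x_{m−1}) analogously with all factors q^{c_i²+c_i} x_i^{c_i} [c_{i+1} choose c_i]_q for i = 1,…,m−2. Then K_m^{(a)}(x_1,…,x_{m−1}) = K_m^{(0)}(q^{−1}x_1,…,q^{−1}x_{a−1}, x_a, x_{a+1},…,x_{m−1}) + q·x_a · K_m^{(a−1)}(x_1,…,x_{a−1}, q·x_a, x_{a+1},…,x_{m−1}). -/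

import Mathlib

open scoped BigOperators

/-- The Gaussian binomial coefficient `[M choose n]_q`: equal to
`(q)_M/((q)_n (q)_{M−n})` for `M ≥ n ≥ 0` and to `0` otherwise; defined via the
`q`-Pascal recursion (hence an integer polynomial in `q`). -/
def qBinom (q : ℂ) : ℕ → ℕ → ℂ
  | _, 0 => 1
  | 0, _ + 1 => 0
  | M + 1, n + 1 => q ^ (n + 1) * qBinom q M (n + 1) + qBinom q M n

/-- General term of the multivariate series `K_m^{(a)}(x_1,…,x_{m−1})` with `m = p+2`,
summed over `c : Fin (p+1) → ℕ` (`c j` is `c_{j+1}`): the last slot contributes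
`(−1)^{c_{m−1}} q^{c_{m−1}(c_{m−1}+1)/2} x_{m−1}^{c_{m−1}}`, slot `i` for `1 ≤ i ≤ a−1`
(resp. `i = a`, resp. `a+1 ≤ i ≤ m−2`) contributes `q^{c_i²} x_i^{c_i} [c_{i+1} choose c_i]_q`
(resp. `q^{c_a²} x_a^{c_a} [c_{a+1}+1 choose c_a]_q`, resp.
`q^{c_i²+c_i} x_i^{c_i} [c_{i+1} choose c_i]_q`); for `a = 0` all slots
`1 ≤ i ≤ m−2` carry `q^{c_i²+c_i} x_i^{c_i} [c_{i+1} choose c_i]_q`. -/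
noncomputable def KtermM (p a : ℕ) (q : ℂ) (x : Fin (p + 1) → ℂ)
    (c : Fin (p + 1) → ℕ) : ℂ :=
  (-1 : ℂ) ^ (c (Fin.last p)) *
    q ^ ((c (Fin.last p) * (c (Fin.last p) + 1)) / 2) *
    (x (Fin.last p)) ^ (c (Fin.last p)) *
    ∏ j : Fin p,
      q ^ ((c j.castSucc) ^ 2 + (if a ≤ (j : ℕ) then c j.castSucc else 0)) *
        (x j.castSucc) ^ (c j.castSucc) *
        qBinom q (c j.succ + (if (j : ℕ) + 1 = a then 1 else 0)) (c j.castSucc)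

theorem norm_qBinom_le {q : ℂ} (hq : ‖q‖ < 1) (M n : ℕ) :
    ‖qBinom q M n‖ ≤ (1 - ‖q‖)⁻¹ ^ n := by
  have h0 : 0 < 1 - ‖q‖ := sub_pos.2 hq
  induction M generalizing n with
  | zero =>
    cases n with
    | zero => simp [qBinom]
    | succ n => simp only [qBinom, norm_zero]; positivity
  | succ M ih =>
    cases n with
    | zero => simp [qBinom]
    | succ n =>
      rw [qBinom]
      have h1 : ‖q‖ ^ (n + 1) ≤ ‖q‖ :=
        pow_le_of_le_one (norm_nonneg q) hq.le n.succ_ne_zero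
      calc ‖q ^ (n + 1) * qBinom q M (n + 1) + qBinom q M n‖
          ≤ ‖q‖ ^ (n + 1) * ‖qBinom q M (n + 1)‖ + ‖qBinom q M n‖ := by
            simpa only [norm_mul, norm_pow] using
              norm_add_le (q ^ (n + 1) * qBinom q M (n + 1)) (qBinom q M n)
        _ ≤ ‖q‖ * (1 - ‖q‖)⁻¹ ^ (n + 1) + (1 - ‖q‖)⁻¹ ^ n := by
            gcongr
            · exact ih _
            · exact ih _
        _ = (1 - ‖q‖)⁻¹ ^ (n + 1) := by
            rw [pow_succ]
            field_simp
            ring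

/-- A finite product of nonnegative summable functions in separate variables is summable. -/
theorem summable_pi_prod_of_nonneg {α : Type*} {n : ℕ} (f : Fin n → α → ℝ)
    (h0 : ∀ j k, 0 ≤ f j k) (hf : ∀ j, Summable (f j)) :
    Summable fun c : Fin n → α => ∏ j, f j (c j) := by
  induction n with
  | zero => exact Summable.of_finite
  | succ n ih =>
    have h := (hf 0).mul_of_nonneg (ih (fun j => f j.succ) (fun j => h0 _) fun j => hf _)
      (h0 0) (fun c => Finset.prod_nonneg fun j _ => h0 _ _)
    rw [← (Fin.consEquiv fun _ : Fin (n + 1) => α).summable_iff]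
    refine h.congr fun c => ?_
    simp [Fin.consEquiv, Fin.prod_univ_succ]

theorem summable_pow_triangle_mul_pow {r : ℝ} (hr0 : 0 < r) (hr1 : r < 1) {y : ℝ} (hy : 0 ≤ y) :
    Summable fun n : ℕ => r ^ (n * (n + 1) / 2) * y ^ n := by
  rcases hy.eq_or_lt with rfl | hy
  · refine summable_of_ne_finset_zero (s := {0}) fun n hn => ?_
    simp_all
  refine summable_of_ratio_test_tendsto_lt_one zero_lt_one
    (Filter.Eventually.of_forall fun n => by positivity) ?_
  have h : Filter.Tendsto (fun n : ℕ => r ^ (n + 1) * y) Filter.atTop (nhds 0) := by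
    simpa using ((Filter.tendsto_add_atTop_iff_nat 1).2
      (tendsto_pow_atTop_nhds_zero_of_lt_one hr0.le hr1)).mul_const y
  refine h.congr fun n => ?_
  have ht : (n + 1) * (n + 1 + 1) / 2 = n * (n + 1) / 2 + (n + 1) := by
    rw [← Nat.add_mul_div_right _ _ two_pos]
    ring_nf
  rw [Real.norm_of_nonneg (by positivity), Real.norm_of_nonneg (by positivity),
    eq_div_iff (by positivity), ht, pow_add, pow_succ y]
  ring

theorem summable_KtermM (p a : ℕ) {q : ℂ} (hq0 : q ≠ 0) (hq1 : ‖q‖ < 1) (x : Fin (p + 1) → ℂ) :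
    Summable fun c : Fin (p + 1) → ℕ => KtermM p a q x c := by
  have hr0 : 0 < ‖q‖ := norm_pos_iff.2 hq0
  have hC0 : 0 < 1 - ‖q‖ := sub_pos.2 hq1
  have hC1 : 1 ≤ (1 - ‖q‖)⁻¹ := (one_le_inv₀ hC0).2 (by linarith)
  refine Summable.of_norm_bounded (summable_pi_prod_of_nonneg
    (fun j n => ‖q‖ ^ (n * (n + 1) / 2) * ((1 - ‖q‖)⁻¹ * ‖x j‖) ^ n)
    (fun j n => by positivity)
    fun j => summable_pow_triangle_mul_pow hr0 hq1 (by positivity)) fun c => ?_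
  rw [KtermM, Fin.prod_univ_castSucc, mul_comm]
  simp only [norm_mul, norm_pow, norm_neg, norm_one, one_pow, one_mul, norm_prod]
  refine mul_le_mul (Finset.prod_le_prod (fun j _ => by positivity) fun j _ => ?_) ?_
    (by positivity) (Finset.prod_nonneg fun j _ => by positivity)
  · have hexp : ∀ n e : ℕ, n * (n + 1) / 2 ≤ n ^ 2 + e := fun n e =>
      Nat.div_le_of_le_mul (by nlinarith [Nat.le_self_pow two_ne_zero n])
    rw [mul_pow, mul_comm (_ ^ c j.castSucc) (‖x _‖ ^ _), ← mul_assoc]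
    gcongr ?_ * _ * ?_
    · exact pow_le_pow_of_le_one hr0.le hq1.le (hexp _ _)
    · exact norm_qBinom_le hq1 _ _
  · gcongr
    exact le_mul_of_one_le_left (norm_nonneg _) hC1

/-- Away from the distinguished slot, the factors of `K^{(k+1)}` agree with those of `K^{(0)}`
after rescaling the arguments before that slot by `q⁻¹`. -/
theorem slot_factor_eq_of_ne {q : ℂ} (hq0 : q ≠ 0) {j k : ℕ} (hjk : j ≠ k) (y : ℂ) (M n : ℕ) :
    q ^ (n ^ 2 + (if k + 1 ≤ j then n else 0)) * y ^ n *
        qBinom q (M + (if j + 1 = k + 1 then 1 else 0)) n =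
      q ^ (n ^ 2 + (if 0 ≤ j then n else 0)) *
        (if j + 1 < k + 1 then q⁻¹ * y else y) ^ n *
        qBinom q (M + (if j + 1 = 0 then 1 else 0)) n := by
  rw [if_neg (by omega : ¬ j + 1 = k + 1), if_neg j.succ_ne_zero, if_pos j.zero_le]
  congr 1
  rcases hjk.lt_or_gt with h | h
  · rw [if_neg (by omega), if_pos (by omega), mul_pow, inv_pow, pow_add _ _ n]
    field_simp
    ring
  · rw [if_pos (by omega), if_neg (by omega)]

theorem KtermM_succ_of_eq_zero {p : ℕ} (k : Fin p) {q : ℂ} (hq0 : q ≠ 0)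
    (x : Fin (p + 1) → ℂ) (c : Fin (p + 1) → ℕ) (hc : c k.castSucc = 0) :
    KtermM p (k + 1) q x c =
      KtermM p 0 q (fun j => if (j : ℕ) + 1 < k + 1 then q⁻¹ * x j else x j) c := by
  have hk := k.isLt
  rw [KtermM, KtermM, if_neg (by simp only [Fin.val_last]; omega)]
  congr 1
  refine Finset.prod_congr rfl fun j _ => ?_
  by_cases h : j = k
  · subst h
    simp [hc, qBinom]
  · exact slot_factor_eq_of_ne hq0 (Fin.val_ne_of_ne h) _ _ _

/-- The `q`-Pascal rule at the distinguished slot, after shifting the distinguished index. -/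
theorem KtermM_succ_update {p : ℕ} (k : Fin p) {q : ℂ} (hq0 : q ≠ 0)
    (x : Fin (p + 1) → ℂ) (c : Fin (p + 1) → ℕ) :
    KtermM p (k + 1) q x (Function.update c k.castSucc (c k.castSucc + 1)) =
      KtermM p 0 q (fun j => if (j : ℕ) + 1 < k + 1 then q⁻¹ * x j else x j)
          (Function.update c k.castSucc (c k.castSucc + 1)) +
        q * x k.castSucc *
          KtermM p k q (fun j => if (j : ℕ) + 1 = k + 1 then q * x j else x j) c := by
  have hk := k.isLt
  set u := Function.update c k.castSucc (c k.castSucc + 1) with hu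
  have hu_self : u k.castSucc = c k.castSucc + 1 := Function.update_self ..
  have hu_ne : ∀ j, j ≠ k.castSucc → u j = c j := fun j hj => Function.update_of_ne hj ..
  have hu_succ : u k.succ = c k.succ := hu_ne _ (by simp [Fin.ext_iff])
  have hu_last : u (Fin.last p) = c (Fin.last p) :=
    hu_ne _ (by simp only [ne_eq, Fin.ext_iff, Fin.val_last, Fin.val_castSucc]; omega)
  simp only [KtermM]
  rw [if_neg (by simp only [Fin.val_last]; omega), if_neg (by simp only [Fin.val_last]; omega)]
  iterate 3 rw [← Finset.mul_prod_erase Finset.univ _ (Finset.mem_univ k)]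
  have h1 : ∀ j ∈ Finset.univ.erase k,
      q ^ ((u j.castSucc) ^ 2 + (if (k : ℕ) + 1 ≤ (j : ℕ) then u j.castSucc else 0)) *
        (x j.castSucc) ^ (u j.castSucc) *
        qBinom q (u j.succ + (if (j : ℕ) + 1 = k + 1 then 1 else 0)) (u j.castSucc) =
      q ^ ((c j.castSucc) ^ 2 + (if (k : ℕ) ≤ (j : ℕ) then c j.castSucc else 0)) *
        (if (j.castSucc : ℕ) + 1 = k + 1 then q * x j.castSucc else x j.castSucc) ^
          (c j.castSucc) *
        qBinom q (c j.succ + (if (j : ℕ) + 1 = k then 1 else 0)) (c j.castSucc) := by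
    intro j hj
    have hjk : (j : ℕ) ≠ k := fun h => (Finset.ne_of_mem_erase hj) (Fin.ext h)
    have hle : (k : ℕ) + 1 ≤ j ↔ (k : ℕ) ≤ j := by omega
    have hs : u j.succ = c j.succ + (if (j : ℕ) + 1 = k then 1 else 0) := by
      split_ifs with h
      · rw [show j.succ = k.castSucc from Fin.ext h, hu_self]
      · exact hu_ne _ fun h' => h (congrArg Fin.val h')
    rw [hu_ne j.castSucc fun h => Finset.ne_of_mem_erase hj (Fin.castSucc_injective p h), hs]
    simp [hjk, hle]
  have h2 : ∀ j ∈ Finset.univ.erase k,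
      q ^ ((u j.castSucc) ^ 2 + (if (k : ℕ) + 1 ≤ (j : ℕ) then u j.castSucc else 0)) *
        (x j.castSucc) ^ (u j.castSucc) *
        qBinom q (u j.succ + (if (j : ℕ) + 1 = k + 1 then 1 else 0)) (u j.castSucc) =
      q ^ ((u j.castSucc) ^ 2 + (if 0 ≤ (j : ℕ) then u j.castSucc else 0)) *
        (if (j.castSucc : ℕ) + 1 < k + 1 then q⁻¹ * x j.castSucc else x j.castSucc) ^
          (u j.castSucc) *
        qBinom q (u j.succ + (if (j : ℕ) + 1 = 0 then 1 else 0)) (u j.castSucc) := fun j hj =>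
    slot_factor_eq_of_ne hq0 (Fin.val_ne_of_ne (Finset.ne_of_mem_erase hj)) _ _ _
  rw [← Finset.prod_congr rfl h2, Finset.prod_congr rfl h1, hu_self, hu_succ, hu_last]
  simp [qBinom]
  ring

/-- for `m ≥ 3` (`m = p+2`, `p ≥ 1`), `1 ≤ a ≤ m−2`, `0 < |q| < 1` and
arbitrary `x_1,…,x_{m−1} : ℂ`, the multivariate series satisfies
`K_m^{(a)}(x_1,…,x_{m−1}) = K_m^{(0)}(q⁻¹x_1,…,q⁻¹x_{a−1},x_a,…,x_{m−1})
 + q x_a K_m^{(a−1)}(x_1,…,x_{a−1}, q x_a, x_{a+1},…,x_{m−1})`. -/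
theorem stmt5 (m p a : ℕ) (hm : m = p + 2) (hm3 : 3 ≤ m) (ha1 : 1 ≤ a) (ha2 : a ≤ m - 2)
    (q : ℂ) (hq0 : q ≠ 0) (hq1 : ‖q‖ < 1) (x : Fin (p + 1) → ℂ) :
    HasSum (fun c : Fin (p + 1) → ℕ => KtermM p a q x c)
      ((∑' c : Fin (p + 1) → ℕ,
          KtermM p 0 q (fun j => if (j : ℕ) + 1 < a then q⁻¹ * x j else x j) c) +
        q * x ⟨a - 1, by omega⟩ *
          ∑' c : Fin (p + 1) → ℕ,
            KtermM p (a - 1) q (fun j => if (j : ℕ) + 1 = a then q * x j else x j) c) := by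
  obtain ⟨k, rfl⟩ : ∃ k : Fin p, a = k + 1 := ⟨⟨a - 1, by omega⟩, by simp only; omega⟩
  simp only [Nat.add_sub_cancel]
  set i : Fin (p + 1) := k.castSucc with hi
  have hshift : Function.Injective fun c : Fin (p + 1) → ℕ => Function.update c i (c i + 1) := by
    intro c d h
    funext j
    have hj := congrFun h j
    by_cases hji : j = i
    · subst hji
      simpa using hj
    · simpa [hji] using hj
  have hfst := (summable_KtermM p 0 hq0 hq1
    fun j => if (j : ℕ) + 1 < k + 1 then q⁻¹ * x j else x j).hasSum
  have hsnd := (summable_KtermM p k hq0 hq1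
    fun j => if (j : ℕ) + 1 = k + 1 then q * x j else x j).hasSum.mul_left (q * x i)
  have hzero : ∀ c ∉ Set.range fun c : Fin (p + 1) → ℕ => Function.update c i (c i + 1),
      KtermM p (k + 1) q x c -
        KtermM p 0 q (fun j => if (j : ℕ) + 1 < k + 1 then q⁻¹ * x j else x j) c = 0 := by
    refine fun c hc => sub_eq_zero.2 (KtermM_succ_of_eq_zero k hq0 x c ?_)
    by_contra h
    refine hc ⟨Function.update c i (c i - 1), ?_⟩
    simp [hi, Nat.sub_add_cancel (Nat.pos_of_ne_zero h)]
  have hdiff := (hshift.hasSum_iff hzero).1 <| by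
    refine hsnd.congr_fun fun c => ?_
    simp only [Function.comp_apply]
    rw [KtermM_succ_update k hq0, add_sub_cancel_left]
  have hsum := hfst.add hdiff
  simp only [add_sub_cancel] at hsum
  exact hsum
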